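/- arXiv:1002.2032 — 3 statements merged into one kernel-verified Lean document; each statement's English description precedes it below -/
import Mathlib

section
/- Let f: (X,x₀) → (Y,y₀) be a pointed continuous map admitting a section, i.e. a pointed continuous map σ: Y → X with σ(y₀) = x₀ and f ∘ σ = id_Y. Then for every n ≥ 1, 𝒢_n(Y,X;f) = π_n(Y): every pointed continuous map a: S^n → Y belongs to 𝒢_n(Y,X;f). -/
/-- The `n`-sphere `Sⁿ`: the unit sphere in euclidean space `ℝ^(n+1)`. -/
noncomputable def Sphere (n : ℕ) : Type :=
  Metric.sphere (0 : EuclideanSpace ℝ (Fin (n + 1))) 1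

noncomputable instance (n : ℕ) : TopologicalSpace (Sphere n) := by
  unfold Sphere; infer_instance

/-- The basepoint `∗` of the `n`-sphere. -/
noncomputable def sphereBase (n : ℕ) : Sphere n :=
  ⟨EuclideanSpace.single 0 1, by simp⟩

/-- The map `i_X : X → Sⁿ × X`, `x ↦ (∗, x)`. -/
noncomputable def iX (n : ℕ) (X : Type*) [TopologicalSpace X] : C(X, Sphere n × X) :=
  ContinuousMap.prodMk (ContinuousMap.const X (sphereBase n)) (ContinuousMap.id X)

/-- Membership in the `n`-th relaxed evaluation subgroup `𝒢ₙ(Y, X; f)` of a map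
`f : X → Y`: there exist a continuous map `s : Sⁿ → Sⁿ × X` with `pr ∘ s` (freely)
homotopic to the identity of `Sⁿ`, and a continuous map `F : Sⁿ × X → Y` with
`F ∘ s` homotopic to `a` and `F ∘ i_X` homotopic to `f` (all homotopies free). -/
noncomputable def InRelaxedEval {X Y : Type*} [TopologicalSpace X] [TopologicalSpace Y]
    (n : ℕ) (f : C(X, Y)) (a : C(Sphere n, Y)) : Prop :=
  ∃ (s : C(Sphere n, Sphere n × X)) (F : C(Sphere n × X, Y)),
    (ContinuousMap.fst.comp s).Homotopic (ContinuousMap.id (Sphere n)) ∧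
    (F.comp s).Homotopic a ∧
    (F.comp (iX n X)).Homotopic f

/-- If `f : X → Y` admits a pointed section `σ` (`σ y₀ = x₀`, `f ∘ σ = id_Y`), then
`𝒢ₙ(Y, X; f) = πₙ(Y)`: every pointed continuous map `a : Sⁿ → Y` belongs to
`𝒢ₙ(Y, X; f)`. -/
theorem stmt8 {X Y : Type*} [TopologicalSpace X] [TopologicalSpace Y]
    (x₀ : X) (y₀ : Y) (n : ℕ) (hn : 1 ≤ n)
    (f : C(X, Y)) (hf : f x₀ = y₀)
    (σ : C(Y, X)) (hσ₀ : σ y₀ = x₀) (hσ : f.comp σ = ContinuousMap.id Y)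
    (a : C(Sphere n, Y)) (ha : a (sphereBase n) = y₀) :
    InRelaxedEval n f a := by
  refine ⟨(ContinuousMap.id _).prodMk (σ.comp a), f.comp ContinuousMap.snd,
    .refl _, ?_, .refl _⟩
  have h : (f.comp ContinuousMap.snd).comp ((ContinuousMap.id _).prodMk (σ.comp a)) = a :=
    ContinuousMap.ext fun t => DFunLike.congr_fun hσ (a t)
  rw [h]
end

section
/- If f: (X,x₀) → (Y,y₀) is a pointed continuous map admitting a pointed section σ: Y → X (σ(y₀) = x₀ and f ∘ σ = id_Y), then for every n ≥ 1 the evaluation subgroup of f equals the Gottlieb group of Y: a pointed continuous map a: S^n → Y belongs to G_n(Y,X;f) if and only if it belongs to G_n(Y) := G_n(Y,Y;id_Y). -/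
/-- The map `i_{Sⁿ} : Sⁿ → Sⁿ × X`, `b ↦ (b, x₀)`. -/
noncomputable def iSn (n : ℕ) {X : Type*} [TopologicalSpace X] (x₀ : X) :
    C(Sphere n, Sphere n × X) :=
  ContinuousMap.prodMk (ContinuousMap.id (Sphere n)) (ContinuousMap.const (Sphere n) x₀)

/-- Membership in the `n`-th evaluation subgroup `Gₙ(Y, X; f)` of a map `f : X → Y`
(with `x₀` the basepoint of `X`): there exists a continuous map `F : Sⁿ × X → Y`
with `F ∘ i_{Sⁿ}` homotopic to `a` and `F ∘ i_X` homotopic to `f` (free homotopies). -/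
noncomputable def InEval {X Y : Type*} [TopologicalSpace X] [TopologicalSpace Y]
    (n : ℕ) (x₀ : X) (f : C(X, Y)) (a : C(Sphere n, Y)) : Prop :=
  ∃ F : C(Sphere n × X, Y),
    (F.comp (iSn n x₀)).Homotopic a ∧ (F.comp (iX n X)).Homotopic f

/-- Membership in an evaluation subgroup is preserved by precomposing with a pointed map. -/
theorem InEval.comp_right {X Y Z : Type*} [TopologicalSpace X] [TopologicalSpace Y]
    [TopologicalSpace Z] {n : ℕ} {x₀ : X} {f : C(X, Y)} {a : C(Sphere n, Y)}
    (h : InEval n x₀ f a) (g : C(Z, X)) {z₀ : Z} (hg : g z₀ = x₀) :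
    InEval n z₀ (f.comp g) a := by
  obtain ⟨F, hFa, hFf⟩ := h
  subst hg
  exact ⟨F.comp ((ContinuousMap.id (Sphere n)).prodMap g), hFa,
    hFf.comp (ContinuousMap.Homotopic.refl g)⟩

/-- If `f : X → Y` admits a pointed section `σ` (`σ y₀ = x₀`, `f ∘ σ = id_Y`), then the
evaluation subgroup equals the Gottlieb group: `a ∈ Gₙ(Y, X; f)` iff
`a ∈ Gₙ(Y) = Gₙ(Y, Y; id_Y)`. -/
theorem stmt9 {X Y : Type*} [TopologicalSpace X] [TopologicalSpace Y]
    (x₀ : X) (y₀ : Y) (n : ℕ) (hn : 1 ≤ n)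
    (f : C(X, Y)) (hf : f x₀ = y₀)
    (σ : C(Y, X)) (hσ₀ : σ y₀ = x₀) (hσ : f.comp σ = ContinuousMap.id Y)
    (a : C(Sphere n, Y)) (ha : a (sphereBase n) = y₀) :
    InEval n x₀ f a ↔ InEval n y₀ (ContinuousMap.id Y) a := by
  constructor
  · intro h
    simpa only [hσ] using h.comp_right σ hσ₀
  · intro h
    simpa only [ContinuousMap.id_comp] using h.comp_right f hf
end

section
/- (Relaxed evaluation subgroup as image of the evaluation map.) Let X be a locally compact Hausdorff pointed space with basepoint x₀, Y a pointed space, f: X → Y a pointed continuous map, and n ≥ 1. A pointed continuous map a: S^n → Y belongs to 𝒢_n(Y,X;f) if and only if there exist continuous maps h: S^n → C(X,Y) (where C(X,Y) is the space of continuous maps X → Y with the compact-open topology) and τ: S^n → X such that h(∗) is homotopic to f and the map b ↦ h(b)(τ(b)) from S^n to Y is homotopic to a. -/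
/-- For `X` locally compact Hausdorff, `a ∈ 𝒢ₙ(Y, X; f)` iff `a` is, up to free homotopy,
in the image of the evaluation map `map(X, Y; f) × X → Y`: there exist continuous
`h : Sⁿ → C(X, Y)` (compact-open topology) and `τ : Sⁿ → X` such that `h(∗)` is homotopic
to `f` and `b ↦ h(b)(τ(b))` is homotopic to `a`. -/
theorem stmt10 {X Y : Type*} [TopologicalSpace X] [TopologicalSpace Y]
    [LocallyCompactSpace X] [T2Space X]
    (x₀ : X) (y₀ : Y) (n : ℕ) (hn : 1 ≤ n)
    (f : C(X, Y)) (hf : f x₀ = y₀)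
    (a : C(Sphere n, Y)) (ha : a (sphereBase n) = y₀) :
    InRelaxedEval n f a ↔
      ∃ (h : C(Sphere n, C(X, Y))) (τ : C(Sphere n, X)) (e : C(Sphere n, Y)),
        (∀ b, e b = (h b) (τ b)) ∧
        (h (sphereBase n)).Homotopic f ∧
        e.Homotopic a := by
  constructor
  · rintro ⟨s, F, hs, hFs, hF⟩
    refine ⟨F.curry, ContinuousMap.snd.comp s,
      F.comp (ContinuousMap.prodMk (ContinuousMap.id _) (ContinuousMap.snd.comp s)),
      fun b => rfl, hF, ?_⟩
    have hprod : (ContinuousMap.prodMk (ContinuousMap.id _) (ContinuousMap.snd.comp s)).Homotopic s :=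
      hs.symm.prodMk (ContinuousMap.Homotopic.refl (ContinuousMap.snd.comp s))
    exact ((ContinuousMap.Homotopic.refl F).comp hprod).trans hFs
  · rintro ⟨h, τ, e, he, hf, ha⟩
    obtain rfl : h.uncurry.comp (ContinuousMap.prodMk (ContinuousMap.id _) τ) = e :=
      ContinuousMap.ext fun b => (he b).symm
    exact ⟨ContinuousMap.prodMk (ContinuousMap.id _) τ, h.uncurry,
      ContinuousMap.Homotopic.refl _, ha, hf⟩
end
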